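/- arXiv:2207.01712 — 2 statements merged into one kernel-verified Lean document; each statement's English description precedes it below -/
import Mathlib

section
/- (Part of Theorem 2.5, relations (2.89) and (2.98)) Under the 3×3 RTT hypothesis, (u−v)·f₁(u)·f₂(v) = (u−v+h)·f₂(v)·f₁(u) + h·(f₃₁(v) − f₃₁(u) − f₂(v)·f₁(v)) and (u−v)·e₂(v)·e₁(u) = (u−v+h)·e₁(u)·e₂(v) + h·(e₁₃(v) − e₁₃(u) − e₁(v)·e₂(v)), as identities in A[[u^{-1}, v^{-1}]][u, v]. -/
noncomputable section

variable {A : Type*} [Ring A]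

/-- A power series in `u⁻¹` (given by its coefficients) viewed as a Hahn series over `ℤ`,
the exponent being the power of `u⁻¹`. -/
def ofSeq {R : Type*} [Ring R] (a : ℕ → R) : HahnSeries ℤ R :=
  HahnSeries.ofPowerSeries ℤ R (PowerSeries.mk a)

/-- The ambient ring containing `A[[u⁻¹, v⁻¹]][u, v]`: iterated Hahn series over `ℤ`
(inner exponent = power of `u⁻¹`, outer exponent = power of `v⁻¹`). -/
abbrev TT (A : Type*) [Ring A] := HahnSeries ℤ (HahnSeries ℤ A)

/-- A power series in `u⁻¹` inside the two-variable ring. -/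
def inU (a : ℕ → A) : TT A := HahnSeries.single (0 : ℤ) (ofSeq a)

/-- A power series in `v⁻¹` inside the two-variable ring. -/
def inV (a : ℕ → A) : TT A := ofSeq (fun m => HahnSeries.single (0 : ℤ) (a m))

/-- A scalar of `A` inside the two-variable ring. -/
def sc (a : A) : TT A := HahnSeries.single (0 : ℤ) (HahnSeries.single (0 : ℤ) a)

/-- The element `u`. -/
def Uv (A : Type*) [Ring A] : TT A := HahnSeries.single (0 : ℤ) (HahnSeries.single (-1 : ℤ) 1)

/-- The element `v`. -/
def Vv (A : Type*) [Ring A] : TT A := HahnSeries.single (-1 : ℤ) 1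

/-- The coefficient sequence of `l_{ij}(u) = δ_{ij} − h·Σ_{r≥0} l_{ij}^{(r)} u^{−r−1}`,
built from the generators `lgen i j r = l_{ij}^{(r)}`. -/
def lcoef {N : ℕ} (h : A) (lgen : Fin N → Fin N → ℕ → A) (i j : Fin N) : ℕ → A :=
  fun r => if r = 0 then (if i = j then 1 else 0) else -(h * lgen i j (r - 1))

/-- The RTT relation for Yang's R-matrix, with denominators cleared:
`(u−v)(l_{ij}(u)l_{kl}(v) − l_{kl}(v)l_{ij}(u)) = h(l_{kj}(v)l_{il}(u) − l_{kj}(u)l_{il}(v))`. -/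
def RTT {N : ℕ} (h : A) (lgen : Fin N → Fin N → ℕ → A) : Prop :=
  ∀ i j k l : Fin N,
    (Uv A - Vv A) *
        (inU (lcoef h lgen i j) * inV (lcoef h lgen k l) -
          inV (lcoef h lgen k l) * inU (lcoef h lgen i j)) =
      sc h *
        (inV (lcoef h lgen k j) * inU (lcoef h lgen i l) -
          inU (lcoef h lgen k j) * inV (lcoef h lgen i l))

section Gauss3

variable {T : Type*} [Ring T]

/-- `k₁ = l₁₁` (in the variable specified by the embedding `emb`). -/
def gk1 (emb : (ℕ → A) → T) (h : A) (lgen : Fin 3 → Fin 3 → ℕ → A) : T :=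
  emb (lcoef h lgen 0 0)

/-- `e₁ = k₁⁻¹·l₁₂`, given the inverse `k1inv` of `k₁`. -/
def ge1 (emb : (ℕ → A) → T) (h : A) (lgen : Fin 3 → Fin 3 → ℕ → A) (k1inv : T) : T :=
  k1inv * emb (lcoef h lgen 0 1)

/-- `e₁₃ = k₁⁻¹·l₁₃`. -/
def ge13 (emb : (ℕ → A) → T) (h : A) (lgen : Fin 3 → Fin 3 → ℕ → A) (k1inv : T) : T :=
  k1inv * emb (lcoef h lgen 0 2)

/-- `f₁ = l₂₁·k₁⁻¹`. -/
def gf1 (emb : (ℕ → A) → T) (h : A) (lgen : Fin 3 → Fin 3 → ℕ → A) (k1inv : T) : T :=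
  emb (lcoef h lgen 1 0) * k1inv

/-- `f₃₁ = l₃₁·k₁⁻¹`. -/
def gf31 (emb : (ℕ → A) → T) (h : A) (lgen : Fin 3 → Fin 3 → ℕ → A) (k1inv : T) : T :=
  emb (lcoef h lgen 2 0) * k1inv

/-- `k₂ = l₂₂ − f₁·k₁·e₁`. -/
def gk2 (emb : (ℕ → A) → T) (h : A) (lgen : Fin 3 → Fin 3 → ℕ → A) (k1inv : T) : T :=
  emb (lcoef h lgen 1 1) - gf1 emb h lgen k1inv * gk1 emb h lgen * ge1 emb h lgen k1inv

/-- `e₂ = k₂⁻¹·(l₂₃ − f₁·k₁·e₁₃)`, given the inverse `k2inv` of `k₂`. -/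
def ge2 (emb : (ℕ → A) → T) (h : A) (lgen : Fin 3 → Fin 3 → ℕ → A) (k1inv k2inv : T) : T :=
  k2inv * (emb (lcoef h lgen 1 2) - gf1 emb h lgen k1inv * gk1 emb h lgen * ge13 emb h lgen k1inv)

/-- `f₂ = (l₃₂ − f₃₁·k₁·e₁)·k₂⁻¹`. -/
def gf2 (emb : (ℕ → A) → T) (h : A) (lgen : Fin 3 → Fin 3 → ℕ → A) (k1inv k2inv : T) : T :=
  (emb (lcoef h lgen 2 1) - gf31 emb h lgen k1inv * gk1 emb h lgen * ge1 emb h lgen k1inv) * k2inv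

end Gauss3

section RTTAlgebra

variable {R T ι : Type*} [CommRing R] [Ring T] [Algebra R T]

/-- Two families `a = L(u)`, `b = L(v)` satisfying the RTT relation with `c = u - v`, in both of its
equivalent forms. -/
structure RTTPair (c h : R) (a b : ι → ι → T) : Prop where
  rel : ∀ i j k l, c • (a i j * b k l - b k l * a i j) = h • (b k j * a i l - a k j * b i l)
  rel' : ∀ i j k l, c • (a i j * b k l - b k l * a i j) = h • (a i l * b k j - b i l * a k j)

theorem RTTPair.of_rel {c h : R} {a b : ι → ι → T}
    (hadd : ∀ x : T, (c + h) • x = 0 → x = 0) (hsub : ∀ x : T, (c - h) • x = 0 → x = 0)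
    (rel : ∀ i j k l,
      c • (a i j * b k l - b k l * a i j) = h • (b k j * a i l - a k j * b i l)) :
    RTTPair c h a b := by
  refine ⟨rel, fun i j k l => ?_⟩
  have h1 := rel i j k l
  have h2 := rel k l i j
  have h3 := rel k j i l
  have h4 := rel i l k j
  have key : (a i j * b k l - b k l * a i j) + (a k l * b i j - b i j * a k l) = 0 := by
    apply hadd
    apply hsub
    linear_combination (norm := module) c • h1 + c • h2 - h • h3 - h • h4
  linear_combination (norm := module) -h2 + c • key

theorem RTTPair.symm {c h : R} {a b : ι → ι → T} (H : RTTPair c h a b) :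
    RTTPair (-c) h b a where
  rel i j k l := by linear_combination (norm := module) H.rel' k l i j
  rel' i j k l := by linear_combination (norm := module) H.rel k l i j

/-- Transposition composed with passing to the opposite ring preserves the RTT relation. -/
theorem RTTPair.op {c h : R} {a b : ι → ι → T} (H : RTTPair c h a b) :
    RTTPair c h (fun i j => MulOpposite.op (a j i)) (fun i j => MulOpposite.op (b j i)) where
  rel i j k l := by
    have := congrArg MulOpposite.op (H.rel j i l k)
    simp only [MulOpposite.op_smul, MulOpposite.op_sub, MulOpposite.op_mul] at this
    linear_combination (norm := module) -this
  rel' i j k l := by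
    have := congrArg MulOpposite.op (H.rel' j i l k)
    simp only [MulOpposite.op_smul, MulOpposite.op_sub, MulOpposite.op_mul] at this
    linear_combination (norm := module) -this

/-- An RTT pair with factored distinguished columns `a k o = p k * x`, `b k o = q k * y`, where
`x = a o o` and `y = b o o` are invertible, together with `e = y⁻¹ * b o s`, `d = x⁻¹ * a o s`. -/
structure GaussPair (c h : R) (a b : ι → ι → T) (o s : ι) (p q : ι → T) (x xi y yi d e : T) :
    Prop extends RTTPair c h a b where
  col_a : ∀ k, a k o = p k * x
  col_b : ∀ k, b k o = q k * y
  p_o : p o = 1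
  q_o : q o = 1
  row_a : a o s = x * d
  row_b : b o s = y * e
  mul_xi : x * xi = 1
  xi_mul : xi * x = 1
  mul_yi : y * yi = 1
  yi_mul : yi * y = 1

namespace GaussPair

variable {c h : R} {a b : ι → ι → T} {o s : ι} {p q : ι → T} {x xi y yi d e : T}

theorem symm (H : GaussPair c h a b o s p q x xi y yi d e) :
    GaussPair (-c) h b a o s q p y yi x xi e d :=
  ⟨H.toRTTPair.symm, H.col_b, H.col_a, H.q_o, H.p_o, H.row_b, H.row_a,
    H.mul_yi, H.yi_mul, H.mul_xi, H.xi_mul⟩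

theorem a_oo (H : GaussPair c h a b o s p q x xi y yi d e) : a o o = x := by
  rw [H.col_a, H.p_o, one_mul]

theorem b_oo (H : GaussPair c h a b o s p q x xi y yi d e) : b o o = y := H.symm.a_oo

theorem comm_p_entry (H : GaussPair c h a b o s p q x xi y yi d e) (k i l : ι) :
    c • (p k * b i l - b i l * p k) =
      h • ((a k l - p k * a o l) * q i * y * xi - (b k l - p k * b o l) * p i) := by
  have h1 := H.rel' k o i l
  have h2 := H.rel' o o i l
  rw [H.a_oo] at h2
  simp only [H.col_a, H.col_b] at h1 h2
  have h3 : (c • (p k * b i l - b i l * p k)) * x =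
      h • ((a k l - p k * a o l) * (q i * y) - (b k l - p k * b o l) * (p i * x)) := by
    linear_combination (norm := skip) h1 - p k * h2
    simp only [mul_sub, sub_mul, smul_mul_assoc, mul_smul_comm, mul_assoc]
    module
  have h4 := congrArg (· * xi) h3
  simpa only [mul_sub, sub_mul, smul_mul_assoc, mul_smul_comm, mul_assoc, H.mul_xi, mul_one]
    using h4

theorem comm_p_y (H : GaussPair c h a b o s p q x xi y yi d e) (k : ι) :
    c • (p k * y - y * p k) = -(h • ((q k - p k) * y)) := by
  have h1 := H.comm_p_entry k o o
  rw [H.b_oo, H.a_oo, H.col_a, H.col_b, H.p_o, H.q_o] at h1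
  rw [h1]
  simp only [sub_mul, mul_one, mul_assoc]
  module

theorem comm_p_q (H : GaussPair c h a b o s p q x xi y yi d e) (k i : ι) :
    c • (p k * q i - q i * p k) =
      h • (q i * (q k - p k) - (q k - p k) * y * p i * yi) := by
  have h1 := H.comm_p_entry k i o
  have h2 := H.comm_p_y k
  rw [H.b_oo, H.a_oo, H.col_a, H.col_b, H.col_b] at h1
  have h3 : (c • (p k * q i - q i * p k)) * y =
      h • (q i * (q k - p k) * y - (q k - p k) * y * p i) := by
    linear_combination (norm := skip) h1 - q i * h2
    simp only [mul_sub, sub_mul, smul_mul_assoc, mul_smul_comm, mul_assoc, mul_neg]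
    module
  have h4 := congrArg (· * yi) h3
  simpa only [mul_sub, sub_mul, smul_mul_assoc, mul_smul_comm, mul_assoc, H.mul_yi, mul_one]
    using h4

/-- `y * [p k, e]`, up to the factor `c`. -/
theorem comm_p_e (H : GaussPair c h a b o s p q x xi y yi d e) (k : ι) :
    c • (y * (p k * e - e * p k)) =
      h • ((a k s - p k * a o s) * y * xi - (b k s - q k * b o s)) := by
  have h1 := H.comm_p_entry k o s
  have h2 := H.comm_p_y k
  rw [H.p_o, H.q_o] at h1
  simp only [H.row_b] at h1 ⊢
  linear_combination (norm := skip) h1 - h2 * e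
  simp only [mul_sub, sub_mul, smul_mul_assoc, mul_assoc, neg_mul, mul_one]
  module

/-- The error term in `comm_p_minor`; it vanishes by `defect_eq_zero`. -/
def defect (a b : ι → ι → T) (o s : ι) (p q : ι → T) (xi y e : T) (k i : ι) : T :=
  (p i * (b k s - q k * b o s) - (b k s - q k * b o s) * p i) +
    (q k - p k) * (y * (p i * e - e * p i)) +
    ((a k s - p k * a o s) * q i - q i * (a k s - p k * a o s)) * y * xi

theorem comm_p_minor_aux (H : GaussPair c h a b o s p q x xi y yi d e) (k i : ι) :
    c • (p k * (b i s - q i * b o s) - (b i s - q i * b o s) * p k) =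
      h • ((q i - p i) * (b k s - q k * b o s) + defect a b o s p q xi y e k i) := by
  have h1 := H.comm_p_entry k i s
  have h2 := H.comm_p_entry k o s
  have h3 := H.comm_p_q k i
  have h4 : yi * (y * e) = e := by rw [← mul_assoc, H.yi_mul, one_mul]
  rw [H.p_o, H.q_o] at h2
  unfold defect
  linear_combination (norm := skip) h1 - q i * h2 - h3 * b o s
  simp only [mul_sub, sub_mul, smul_mul_assoc, mul_smul_comm, mul_assoc, mul_one, h4,
    H.row_b]
  module

theorem smul_defect (H : GaussPair c h a b o s p q x xi y yi d e) (k i : ι) :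
    c • defect a b o s p q xi y e k i =
      h • (defect a b o s p q xi y e i k + defect b a o s q p yi x d i k * (y * xi)) := by
  have h1 := H.comm_p_minor_aux i k
  have h2 := H.comm_p_e i
  have h3 := H.symm.comm_p_minor_aux i k
  generalize hE : defect a b o s p q xi y e i k = E at *
  generalize hE' : defect b a o s q p yi x d i k = E' at *
  unfold defect
  linear_combination (norm := skip) h1 + (q k - p k) * h2 + h3 * (y * xi)
  simp only [mul_sub, sub_mul, add_mul, smul_mul_assoc, mul_smul_comm, mul_assoc]
  module

theorem defect_eq_zero (H : GaussPair c h a b o s p q x xi y yi d e)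
    (hc : ∀ z : T, c • z = 0 → z = 0) (k i : ι) : defect a b o s p q xi y e k i = 0 := by
  have key (k i : ι) :
      defect a b o s p q xi y e k i + defect b a o s q p yi x d k i * (y * xi) = 0 := by
    have h1 := H.smul_defect k i
    have h2 := H.symm.smul_defect k i
    have h3 : x * (yi * (y * xi)) = 1 := by rw [← mul_assoc yi, H.yi_mul, one_mul, H.mul_xi]
    apply hc
    linear_combination (norm := skip) h1 - h2 * (y * xi)
    simp only [add_mul, smul_mul_assoc, mul_assoc, h3, mul_one]
    module
  apply hc
  rw [H.smul_defect, key, smul_zero]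

theorem comm_p_minor (H : GaussPair c h a b o s p q x xi y yi d e)
    (hc : ∀ z : T, c • z = 0 → z = 0) (k i : ι) :
    c • (p k * (b i s - q i * b o s) - (b i s - q i * b o s) * p k) =
      h • ((q i - p i) * (b k s - q k * b o s)) := by
  rw [H.comm_p_minor_aux, H.defect_eq_zero hc, add_zero]

/-- The relation between `f₁(u) = p k` and `f₂(v) = (b i s - q i * b o s) * m`, where `m` is the
inverse of `k₂(v) = b k s - q k * b o s`. -/
theorem p_mul_minor (H : GaussPair c h a b o s p q x xi y yi d e)
    (hc : ∀ z : T, c • z = 0 → z = 0) (k i : ι) {m : T}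
    (hm : (b k s - q k * b o s) * m = 1) (hm' : m * (b k s - q k * b o s) = 1) :
    c • (p k * ((b i s - q i * b o s) * m)) =
      (c + h) • ((b i s - q i * b o s) * m * p k) +
        h • (q i - p i - (b i s - q i * b o s) * m * q k) := by
  have h1 := H.comm_p_minor hc k i
  have h2 := H.comm_p_minor hc k k
  generalize b k s - q k * b o s = M at *
  generalize b i s - q i * b o s = G at *
  have h3 (z : T) : m * (M * z) = z := by rw [← mul_assoc, hm', one_mul]
  linear_combination (norm := skip) h1 * m - G * m * h2 * m
  simp only [mul_sub, sub_mul, smul_mul_assoc, mul_smul_comm, mul_assoc, h3, hm, mul_one]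
  module

end GaussPair

/-- The relation between `f₁(u)` and `f₂(v)` in terms of the entries of `a = L(u)` and
`b = L(v)`. -/
theorem RTTPair.gauss_relation {c h : R} {a b : ι → ι → T} (H : RTTPair c h a b)
    (hc : ∀ z : T, c • z = 0 → z = 0) (o s t : ι) {xi yi m : T}
    (hx : a o o * xi = 1) (hx' : xi * a o o = 1) (hy : b o o * yi = 1) (hy' : yi * b o o = 1)
    (hm : (b s s - b s o * yi * b o s) * m = 1) (hm' : m * (b s s - b s o * yi * b o s) = 1) :
    c • (a s o * xi * ((b t s - b t o * yi * b o s) * m)) =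
      (c + h) • ((b t s - b t o * yi * b o s) * m * (a s o * xi)) +
        h • (b t o * yi - a t o * xi - (b t s - b t o * yi * b o s) * m * (b s o * yi)) := by
  have G : GaussPair c h a b o s (fun k => a k o * xi) (fun k => b k o * yi) (a o o) xi (b o o) yi
      (xi * a o s) (yi * b o s) :=
    { toRTTPair := H
      col_a := fun k => by rw [mul_assoc, hx', mul_one]
      col_b := fun k => by rw [mul_assoc, hy', mul_one]
      p_o := hx
      q_o := hy
      row_a := by rw [← mul_assoc, hx, one_mul]
      row_b := by rw [← mul_assoc, hy, one_mul]
      mul_xi := hx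
      xi_mul := hx'
      mul_yi := hy
      yi_mul := hy' }
  exact G.p_mul_minor hc s t hm hm'

/-- The relation between `e₂(v)` and `e₁(u)` in terms of the entries of `a = L(u)` and
`b = L(v)`. -/
theorem RTTPair.gauss_relation_op {c h : R} {a b : ι → ι → T} (H : RTTPair c h a b)
    (hc : ∀ z : T, c • z = 0 → z = 0) (o s t : ι) {xi yi m : T}
    (hx : a o o * xi = 1) (hx' : xi * a o o = 1) (hy : b o o * yi = 1) (hy' : yi * b o o = 1)
    (hm : (b s s - b s o * yi * b o s) * m = 1) (hm' : m * (b s s - b s o * yi * b o s) = 1) :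
    c • (m * (b s t - b s o * yi * b o t) * (xi * a o s)) =
      (c + h) • (xi * a o s * (m * (b s t - b s o * yi * b o t))) +
        h • (yi * b o t - xi * a o t - yi * b o s * (m * (b s t - b s o * yi * b o t))) := by
  simp only [mul_assoc (b s o)] at hm hm' ⊢
  exact congrArg MulOpposite.unop (H.op.gauss_relation
    (fun z hz => MulOpposite.unop_injective (hc z.unop (congrArg MulOpposite.unop hz))) o s t
    (congrArg MulOpposite.op hx') (congrArg MulOpposite.op hx)
    (congrArg MulOpposite.op hy') (congrArg MulOpposite.op hy)
    (congrArg MulOpposite.op hm') (congrArg MulOpposite.op hm))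

/-- The relations `RTTPair.gauss_relation` and `RTTPair.gauss_relation_op` for central elements
`c` and `h` of the ring itself. -/
theorem gauss_relations_of_central {c h : T} (hc : ∀ x, Commute c x) (hh : ∀ x, Commute h x)
    (hreg : ∀ x, c * x = 0 → x = 0) (hadd : ∀ x, (c + h) * x = 0 → x = 0)
    (hsub : ∀ x, (c - h) * x = 0 → x = 0) {a b : ι → ι → T}
    (rel : ∀ i j k l,
      c * (a i j * b k l - b k l * a i j) = h * (b k j * a i l - a k j * b i l))
    (o s t : ι) {xi yi m : T}
    (hx : a o o * xi = 1) (hx' : xi * a o o = 1) (hy : b o o * yi = 1) (hy' : yi * b o o = 1)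
    (hm : (b s s - b s o * yi * b o s) * m = 1) (hm' : m * (b s s - b s o * yi * b o s) = 1) :
    c * (a s o * xi * ((b t s - b t o * yi * b o s) * m)) =
        (c + h) * ((b t s - b t o * yi * b o s) * m * (a s o * xi)) +
          h * (b t o * yi - a t o * xi - (b t s - b t o * yi * b o s) * m * (b s o * yi)) ∧
      c * (m * (b s t - b s o * yi * b o t) * (xi * a o s)) =
        (c + h) * (xi * a o s * (m * (b s t - b s o * yi * b o t))) +
          h * (yi * b o t - xi * a o t - yi * b o s * (m * (b s t - b s o * yi * b o t))) := by
  let c' : Subring.center T := ⟨c, Subring.mem_center_iff.2 fun x => (hc x).eq.symm⟩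
  let h' : Subring.center T := ⟨h, Subring.mem_center_iff.2 fun x => (hh x).eq.symm⟩
  have H : RTTPair c' h' a b := RTTPair.of_rel hadd hsub rel
  exact ⟨H.gauss_relation hreg o s t hx hx' hy hy' hm hm',
    H.gauss_relation_op hreg o s t hx hx' hy hy' hm hm'⟩

end RTTAlgebra

theorem HahnSeries.commute_single {S : Type*} [Ring S] {r : S} (hr : ∀ s : S, Commute r s) (n : ℤ)
    (x : HahnSeries ℤ S) : Commute (HahnSeries.single n r) x := by
  ext m
  rw [HahnSeries.coeff_single_mul, HahnSeries.coeff_mul_single, (hr _).eq]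

theorem HahnSeries.eq_zero_of_single_sub_single_mul {S : Type*} [Ring S] (r : S)
    (x : HahnSeries ℤ S)
    (hx : (HahnSeries.single (0 : ℤ) r - HahnSeries.single (-1 : ℤ) 1) * x = 0) : x = 0 := by
  rw [← HahnSeries.coeff_order_eq_zero]
  have h1 := congrArg (fun y => HahnSeries.coeff y (x.order - 1)) hx
  simp only [sub_mul, HahnSeries.coeff_sub, HahnSeries.coeff_single_mul, HahnSeries.coeff_zero,
    sub_zero, one_mul, sub_neg_eq_add, sub_add_cancel] at h1
  rwa [HahnSeries.coeff_eq_zero_of_lt_order (by omega), mul_zero, zero_sub, neg_eq_zero] at h1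

theorem commute_Uv_sub_Vv (x : TT A) : Commute (Uv A - Vv A) x :=
  (HahnSeries.commute_single
    (fun y => HahnSeries.commute_single (fun a => Commute.one_left a) _ y) _ x).sub_left
    (HahnSeries.commute_single (fun y => Commute.one_left y) _ x)

theorem commute_sc {h : A} (hcen : ∀ a : A, a * h = h * a) (x : TT A) : Commute (sc h) x :=
  HahnSeries.commute_single
    (fun y => HahnSeries.commute_single (fun a => (hcen a).symm) _ y) _ x

theorem eq_zero_of_Uv_sub_Vv_mul (x : TT A) (hx : (Uv A - Vv A) * x = 0) : x = 0 :=
  HahnSeries.eq_zero_of_single_sub_single_mul _ x hx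

theorem eq_zero_of_Uv_sub_Vv_add_sc_mul (h : A) (x : TT A)
    (hx : (Uv A - Vv A + sc h) * x = 0) : x = 0 := by
  refine HahnSeries.eq_zero_of_single_sub_single_mul
    (HahnSeries.single (-1 : ℤ) 1 + HahnSeries.single (0 : ℤ) h) x ?_
  rw [HahnSeries.single_add, add_sub_right_comm]
  exact hx

theorem eq_zero_of_Uv_sub_Vv_sub_sc_mul (h : A) (x : TT A)
    (hx : (Uv A - Vv A - sc h) * x = 0) : x = 0 := by
  refine HahnSeries.eq_zero_of_single_sub_single_mul
    (HahnSeries.single (-1 : ℤ) 1 - HahnSeries.single (0 : ℤ) h) x ?_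
  rw [HahnSeries.single_sub, sub_right_comm]
  exact hx

/-- Relations (2.89) and (2.98):
`(u−v)·f₁(u)f₂(v) = (u−v+h)·f₂(v)f₁(u) + h·(f₃₁(v) − f₃₁(u) − f₂(v)f₁(v))` and
`(u−v)·e₂(v)e₁(u) = (u−v+h)·e₁(u)e₂(v) + h·(e₁₃(v) − e₁₃(u) − e₁(v)e₂(v))`. -/
theorem stmt17 (h : A) (hcen : ∀ a : A, a * h = h * a)
    (lgen : Fin 3 → Fin 3 → ℕ → A) (hRTT : RTT h lgen)
    (k1uinv k1vinv k2uinv k2vinv : TT A)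
    (hk1u : gk1 inU h lgen * k1uinv = 1 ∧ k1uinv * gk1 inU h lgen = 1)
    (hk1v : gk1 inV h lgen * k1vinv = 1 ∧ k1vinv * gk1 inV h lgen = 1)
    (hk2u : gk2 inU h lgen k1uinv * k2uinv = 1 ∧ k2uinv * gk2 inU h lgen k1uinv = 1)
    (hk2v : gk2 inV h lgen k1vinv * k2vinv = 1 ∧ k2vinv * gk2 inV h lgen k1vinv = 1) :
    (Uv A - Vv A) * (gf1 inU h lgen k1uinv * gf2 inV h lgen k1vinv k2vinv) =
        ((Uv A - Vv A) + sc h) * (gf2 inV h lgen k1vinv k2vinv * gf1 inU h lgen k1uinv) +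
          sc h * (gf31 inV h lgen k1vinv - gf31 inU h lgen k1uinv -
            gf2 inV h lgen k1vinv k2vinv * gf1 inV h lgen k1vinv) ∧
      (Uv A - Vv A) * (ge2 inV h lgen k1vinv k2vinv * ge1 inU h lgen k1uinv) =
        ((Uv A - Vv A) + sc h) * (ge1 inU h lgen k1uinv * ge2 inV h lgen k1vinv k2vinv) +
          sc h * (ge13 inV h lgen k1vinv - ge13 inU h lgen k1uinv -
            ge1 inV h lgen k1vinv * ge2 inV h lgen k1vinv k2vinv) := by
  have hmid (i j : Fin 3) :
      inV (lcoef h lgen i 0) * k1vinv * gk1 inV h lgen * (k1vinv * inV (lcoef h lgen 0 j)) =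
        inV (lcoef h lgen i 0) * k1vinv * inV (lcoef h lgen 0 j) := by
    rw [mul_assoc _ (gk1 inV h lgen), ← mul_assoc (gk1 inV h lgen), hk1v.1, one_mul]
  simp only [gk2, gf1, ge1, hmid] at hk2v
  simp only [gf1, gf2, gf31, ge1, ge2, ge13, hmid]
  exact gauss_relations_of_central commute_Uv_sub_Vv (commute_sc hcen) eq_zero_of_Uv_sub_Vv_mul
    (eq_zero_of_Uv_sub_Vv_add_sc_mul h) (eq_zero_of_Uv_sub_Vv_sub_sc_mul h)
    (a := fun i j => inU (lcoef h lgen i j)) (b := fun i j => inV (lcoef h lgen i j)) hRTT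
    0 1 2 hk1u.1 hk1u.2 hk1v.1 hk1v.2 hk2v.1 hk2v.2
end
end

section
/- (Part of Theorem 2.5, Serre relations (2.101)–(2.102)) Under the 3×3 RTT hypothesis, the Gauss coordinates satisfy the cubic Serre relations: e₁(u₁)e₁(u₂)e₂(v) − 2·e₁(u₁)e₂(v)e₁(u₂) + e₂(v)e₁(u₁)e₁(u₂) + (the same expression with u₁ and u₂ interchanged) = 0, and f₁(u₁)f₁(u₂)f₂(v) − 2·f₁(u₁)f₂(v)f₁(u₂) + f₂(v)f₁(u₁)f₁(u₂) + (the same expression with u₁ and u₂ interchanged) = 0, as identities in A[[u₁^{-1}, u₂^{-1}, v^{-1}]]. -/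
set_option maxSynthPendingDepth 3
noncomputable section

variable {A : Type*} [Ring A]

/-- The three-variable ring `A[[u₁⁻¹, u₂⁻¹, v⁻¹]]` (inside iterated Hahn series:
inner = `u₁`, middle = `u₂`, outer = `v`). -/
abbrev T3 (A : Type*) [Ring A] := HahnSeries ℤ (TT A)

/-- A power series in `u₁⁻¹` inside the three-variable ring. -/
def in1 (a : ℕ → A) : T3 A := HahnSeries.single (0 : ℤ) (inU a)

/-- A power series in `u₂⁻¹` inside the three-variable ring. -/
def in2 (a : ℕ → A) : T3 A := HahnSeries.single (0 : ℤ) (inV a)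

/-- A power series in `v⁻¹` inside the three-variable ring. -/
def in3 (a : ℕ → A) : T3 A := ofSeq (fun m => sc (a m))

set_option linter.unusedSimpArgs false

section Exchange

variable {K R : Type*} [CommRing K] [Ring R] [Algebra K R]

/-- The RTT relation between two matrices over an algebra, with scalar parameters `x` and `h`. -/
def Exchange (x h : K) (a b : Fin 3 → Fin 3 → R) : Prop :=
  ∀ i j k l : Fin 3,
    x • (a i j * b k l - b k l * a i j) = h • (b k j * a i l - a k j * b i l)

/-- Commuting `k = k₁(u)` and `k' = k₁(u')` past `E' = e(u')` and `E = e(u)`. -/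
theorem diag_exchange {x h : K} (hxh : ∀ r : R, (x + h) • r = 0 → r = 0)
    {k k' ki ki' E E' : R} (hk : ki * k = 1) (hk' : ki' * k' = 1) (hkk : k * k' = k' * k)
    (H₁ : x • (k * (k' * E') - (k' * E') * k) = h • (k' * (k * E) - k * (k' * E')))
    (H₂ : x • ((k * E) * k' - k' * (k * E)) = h • ((k' * E') * k - (k * E) * k')) :
    x • (k * E' - E' * k) = h • (k * (E - E')) ∧
      x • (E * k' - k' * E) = -(h • (k' * (E - E'))) := by
  have R₁ : x • (k * E' - E' * k) = h • (k * (E - E')) := by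
    have e : k' * (x • (k * E' - E' * k) - h • (k * (E - E'))) = 0 := by
      linear_combination (norm := skip) H₁ - (x + h) • (hkk * E')
      simp only [mul_sub, sub_mul, smul_sub, mul_smul_comm, mul_assoc]
      module
    have e' := congr(ki' * $e)
    rw [← mul_assoc, hk', one_mul, mul_zero] at e'
    exact sub_eq_zero.1 e'
  refine ⟨R₁, ?_⟩
  have e : (x + h) • (k * (x • (E * k' - k' * E) + h • (k' * (E - E')))) = 0 := by
    linear_combination (norm := skip) x • H₂ - h • (k' * R₁) - (x * (x + h) : K) • (hkk * E)
      + ((x + h) * h : K) • (hkk * (E - E'))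
    simp only [mul_add, mul_sub, sub_mul, smul_sub, smul_add, mul_smul_comm, smul_smul, mul_assoc]
    module
  have e' := congr(ki * $(hxh _ e))
  rw [← mul_assoc, hk, one_mul, mul_zero] at e'
  exact eq_neg_of_add_eq_zero_left e'

/-- The relation between `E = e(u)` and `G' = g(u')` for two entries `e`, `g` of the
first row of the upper triangular Gauss factor. -/
theorem row_exchange {x h : K} {k k' ki ki' E E' G G' : R}
    (hk : ki * k = 1) (hk' : ki' * k' = 1) (hkk : k * k' = k' * k)
    (hE : x • (k * E' - E' * k) = h • (k * (E - E')))
    (hE' : x • (E * k' - k' * E) = -(h • (k' * (E - E'))))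
    (hG : x • (k * G' - G' * k) = h • (k * (G - G')))
    (H : x • ((k * E) * (k' * G') - (k' * G') * (k * E)) =
      h • ((k' * E') * (k * G) - (k * E) * (k' * G'))) :
    (x + h) • (x • (E * G' - G' * E) + h • ((E - E') * (G - G'))) =
      (x * h) • (E * G - G * E) := by
  have e : k' * (k * ((x + h) • (x • (E * G' - G' * E) + h • ((E - E') * (G - G'))) -
      (x * h) • (E * G - G * E))) = 0 := by
    linear_combination (norm := skip) x • H - (x + h) • (k * hE' * G')
      - ((x + h) * x : K) • (hkk * (E * G')) - x • (k' * hG * E)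
      - h • (k' * hE * G) + ((x + h) * h : K) • (hkk * ((E - E') * G'))
    simp only [mul_add, mul_sub, sub_mul, smul_sub, smul_add, smul_mul_assoc, mul_smul_comm,
      smul_smul, mul_assoc, mul_neg, neg_mul, smul_neg]
    module
  have e' := congr(ki * (ki' * $e))
  rw [← mul_assoc ki', hk', one_mul, ← mul_assoc ki, hk, one_mul, mul_zero, mul_zero] at e'
  exact sub_eq_zero.1 e'

/-- In the opposite algebra, transposing the matrices preserves the RTT relation. -/
theorem Exchange.op {x h : K} {a b : Fin 3 → Fin 3 → R} (H : Exchange x h a b) :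
    Exchange x h (fun i j ↦ MulOpposite.op (a j i)) (fun i j ↦ MulOpposite.op (b j i)) := by
  intro i j k l
  apply MulOpposite.unop_injective
  simp only [MulOpposite.unop_smul, MulOpposite.unop_sub, MulOpposite.unop_mul,
    MulOpposite.unop_op]
  linear_combination (norm := module) -H j i l k

/-- The relations between the entries of the first rows of the upper triangular Gauss factors. -/
theorem first_row_exchange {x h : K} (hxh : ∀ r : R, (x + h) • r = 0 → r = 0)
    {a b : Fin 3 → Fin 3 → R} (H : Exchange x h a b) {ki ki' : R}
    (hk : a 0 0 * ki = 1 ∧ ki * a 0 0 = 1) (hk' : b 0 0 * ki' = 1 ∧ ki' * b 0 0 = 1)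
    (i j : Fin 3) :
    (x + h) • (x • ((ki * a 0 i) * (ki' * b 0 j) - (ki' * b 0 j) * (ki * a 0 i)) +
        h • ((ki * a 0 i - ki' * b 0 i) * (ki * a 0 j - ki' * b 0 j))) =
      (x * h) • ((ki * a 0 i) * (ki * a 0 j) - (ki * a 0 j) * (ki * a 0 i)) := by
  have ha (j : Fin 3) : a 0 0 * (ki * a 0 j) = a 0 j := by rw [← mul_assoc, hk.1, one_mul]
  have hb (j : Fin 3) : b 0 0 * (ki' * b 0 j) = b 0 j := by rw [← mul_assoc, hk'.1, one_mul]
  have hkk : a 0 0 * b 0 0 = b 0 0 * a 0 0 :=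
    sub_eq_zero.1 <| hxh _ <| by linear_combination (norm := module) H 0 0 0 0
  have h₁ (j : Fin 3) := diag_exchange hxh hk.2 hk'.2 hkk (E := ki * a 0 j) (E' := ki' * b 0 j)
    (by rw [ha, hb]; exact H 0 0 0 j) (by rw [ha, hb]; exact H 0 j 0 0)
  exact row_exchange hk.2 hk'.2 hkk (h₁ i).1 (h₁ i).2 (h₁ j).1
    (by rw [ha, hb, ha, hb]; exact H 0 i 0 j)

/-- If `(-X, C)` solves the linear system with matrix `(c i j)` and right-hand side `(c i 2)`, then
the commutators of `k₁(u) = k` and `e₁(u) = E` with `X` and `C` are as follows. -/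
theorem column_exchange {y h : K} (hy : ∀ r : R, y • r = 0 → r = 0)
    {a c : Fin 3 → Fin 3 → R} (H : Exchange y h a c) {ki E G C X : R}
    (hk : ki * a 0 0 = 1) (hE : a 0 1 = a 0 0 * E) (hG : a 0 2 = a 0 0 * G)
    (h₀ : c 0 1 * C - c 0 0 * X = c 0 2) (h₁ : c 1 1 * C - c 1 0 * X = c 1 2)
    (hc : ∀ r s : R, c 0 0 * r + c 0 1 * s = 0 → c 1 0 * r + c 1 1 * s = 0 → r = 0 ∧ s = 0) :
    y • (E * C - C * E) = h • (G + X - E * C) ∧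
      y • (E * X - X * E) = h • ((G + X - E * C) * E) := by
  have key (j i : Fin 3) (hi : c i 1 * C - c i 0 * X = c i 2) :
      c i 0 * (-(y • (a 0 j * X - X * a 0 j))) + c i 1 * (y • (a 0 j * C - C * a 0 j)) =
        h • (c i j * (a 0 2 + a 0 0 * X - a 0 1 * C)) := by
    linear_combination (norm := skip) H 0 j i 2 + H 0 j i 0 * X - H 0 j i 1 * C
      + y • (a 0 j * hi) - y • (hi * a 0 j) + h • (a i j * h₀)
    simp only [mul_add, mul_sub, add_mul, sub_mul, smul_sub, smul_add, smul_mul_assoc,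
      mul_smul_comm, smul_smul, mul_assoc, mul_neg, neg_mul, smul_neg, mul_zero, zero_mul]
    module
  have e₀ := hc (-(y • (a 0 0 * X - X * a 0 0)) - h • (a 0 2 + a 0 0 * X - a 0 1 * C))
    (y • (a 0 0 * C - C * a 0 0))
    (by linear_combination (norm := (simp only [mul_sub, mul_smul_comm]; module)) key 0 0 h₀)
    (by linear_combination (norm := (simp only [mul_sub, mul_smul_comm]; module)) key 0 1 h₁)
  have e₁ := hc (-(y • (a 0 1 * X - X * a 0 1)))
    (y • (a 0 1 * C - C * a 0 1) - h • (a 0 2 + a 0 0 * X - a 0 1 * C))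
    (by linear_combination (norm := (simp only [mul_sub, mul_smul_comm]; module)) key 1 0 h₀)
    (by linear_combination (norm := (simp only [mul_sub, mul_smul_comm]; module)) key 1 1 h₁)
  obtain ⟨e₀X, e₀C⟩ := e₀
  obtain ⟨e₁X, e₁C⟩ := e₁
  have kC := hy _ e₀C
  rw [← smul_neg] at e₁X
  have aX := hy _ e₁X
  rw [hE, hG] at e₀X e₁C
  rw [hE] at aX
  have cancel {r s : R} (hrs : a 0 0 * (r - s) = 0) : r = s := by
    have e' := congr(ki * $hrs)
    rw [← mul_assoc, hk, one_mul, mul_zero] at e'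
    exact sub_eq_zero.1 e'
  constructor <;> apply cancel
  · linear_combination (norm := skip) e₁C - y • (kC * E)
    simp only [mul_add, mul_sub, add_mul, sub_mul, smul_sub, smul_add, smul_mul_assoc,
      mul_smul_comm, smul_smul, mul_assoc, mul_neg, neg_mul, smul_neg, mul_zero, zero_mul]
    module
  · linear_combination (norm := skip) e₀X * E - y • aX
    simp only [mul_add, mul_sub, add_mul, sub_mul, smul_sub, smul_add, smul_mul_assoc,
      mul_smul_comm, smul_smul, mul_assoc, mul_neg, neg_mul, smul_neg, mul_zero, zero_mul]
    module

/-- The cubic Serre relation follows from the quadratic exchange relations. -/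
theorem serre_of_exchange {x y z h : K} (hxyz : x = y - z)
    (hxh : ∀ r : R, (x - h) • r = 0 → r = 0)
    (hy : ∀ r : R, y • r = 0 → r = 0) (hz : ∀ r : R, z • r = 0 → r = 0)
    (hyh : ∀ r : R, (y + h) • r = 0 → r = 0) (hzh : ∀ r : R, (z + h) • r = 0 → r = 0)
    {E E' G G' C X : R}
    (hC : y • (E * C - C * E) = h • (G + X - E * C))
    (hX : y • (E * X - X * E) = h • ((G + X - E * C) * E))
    (hC' : z • (E' * C - C * E') = h • (G' + X - E' * C))
    (hX' : z • (E' * X - X * E') = h • ((G' + X - E' * C) * E'))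
    (hEE : x • (E * E' - E' * E) + h • ((E - E') * (E - E')) = 0)
    (hEG : h • (x • (E * G' - G' * E) + h • ((E - E') * (G - G'))) = 0)
    (hGE : h • (x • (G * E' - E' * G) + h • ((G - G') * (E - E'))) = 0)
    (hd : (h * h) • (E * G - G * E) = 0) (hd' : (h * h) • (E' * G' - G' * E') = 0) :
    (E * E' * C - 2 * (E * C * E') + C * E * E') +
      (E' * E * C - 2 * (E' * C * E) + C * E' * E) = 0 := by
  have comm_q {y : K} {E G : R} (hy : ∀ r : R, y • r = 0 → r = 0)
      (hyh : ∀ r : R, (y + h) • r = 0 → r = 0)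
      (hC : y • (E * C - C * E) = h • (G + X - E * C))
      (hX : y • (E * X - X * E) = h • ((G + X - E * C) * E))
      (hd : (h * h) • (E * G - G * E) = 0) :
      (h * h) • (X * E - E * X - E * (C * E) + E * (E * C)) = 0 := by
    have e : (h * h) • (E * (G + X - E * C) - (G + X - E * C) * E) = 0 := by
      apply hyh
      linear_combination (norm := skip) y • hd + (h * h) • hX - (h * h) • (E * hC)
      simp only [mul_add, mul_sub, add_mul, sub_mul, smul_sub, smul_add, smul_mul_assoc,
        mul_smul_comm, smul_smul, mul_assoc, mul_neg, neg_mul, smul_neg, mul_zero, zero_mul]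
      module
    apply hy
    linear_combination (norm := skip) h • e - (h * h) • hX + (h * h) • (E * hC)
    simp only [mul_add, mul_sub, add_mul, sub_mul, smul_sub, smul_add, smul_mul_assoc,
      mul_smul_comm, smul_smul, mul_assoc, mul_neg, neg_mul, smul_neg, mul_zero, zero_mul]
    module
  have q := comm_q hy hyh hC hX hd
  have q' := comm_q hz hzh hC' hX' hd'
  have st : h • ((E * G' - G' * E) + (E' * G - G * E')) = 0 := by
    apply hxh
    linear_combination (norm := skip) hEG - hGE - hd - hd'
    simp only [mul_add, mul_sub, add_mul, sub_mul, smul_sub, smul_add, smul_mul_assoc,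
      mul_smul_comm, smul_smul, mul_assoc, mul_neg, neg_mul, smul_neg, mul_zero, zero_mul]
    module
  apply hy
  apply hz
  subst hxyz
  linear_combination (norm := skip) y • (E * hC' - hC' * E) + z • (E' * hC - hC * E')
    + h • (hX + hX') - h • (E' * hC + E * hC') - h • (hEE * C) + z • st + hEG + q + q' - hd - hd'
  simp only [mul_add, mul_sub, add_mul, sub_mul, smul_sub, smul_add, smul_mul_assoc, two_mul,
    mul_smul_comm, smul_smul, mul_assoc, mul_neg, neg_mul, smul_neg, mul_zero, zero_mul]
  module

/-- The cubic Serre relation for the Gauss coordinates of three matrices satisfying the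
pairwise RTT relations. -/
theorem gauss_serre {x y z h : K} (hxyz : x = y - z)
    (hx : ∀ r : R, (x + h) • r = 0 → r = 0) (hx' : ∀ r : R, (x - h) • r = 0 → r = 0)
    (hy : ∀ r : R, y • r = 0 → r = 0) (hz : ∀ r : R, z • r = 0 → r = 0)
    (hyh : ∀ r : R, (y + h) • r = 0 → r = 0) (hzh : ∀ r : R, (z + h) • r = 0 → r = 0)
    {a b c : Fin 3 → Fin 3 → R} (hab : Exchange x h a b) (hac : Exchange y h a c)
    (hbc : Exchange z h b c) {ka kb kc kc₂ : R}
    (hka : a 0 0 * ka = 1 ∧ ka * a 0 0 = 1) (hkb : b 0 0 * kb = 1 ∧ kb * b 0 0 = 1)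
    (hkc : c 0 0 * kc = 1 ∧ kc * c 0 0 = 1)
    (hkc₂ : (c 1 1 - c 1 0 * kc * c 0 1) * kc₂ = 1 ∧ kc₂ * (c 1 1 - c 1 0 * kc * c 0 1) = 1)
    (hd : (h * h) • (ka * a 0 1 * (ka * a 0 2) - ka * a 0 2 * (ka * a 0 1)) = 0)
    (hd' : (h * h) • (kb * b 0 1 * (kb * b 0 2) - kb * b 0 2 * (kb * b 0 1)) = 0)
    {E E' C : R} (hE : E = ka * a 0 1) (hE' : E' = kb * b 0 1)
    (hC : C = kc₂ * (c 1 2 - c 1 0 * kc * c 0 2)) :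
    (E * E' * C - 2 * (E * C * E') + C * E * E') +
      (E' * E * C - 2 * (E' * C * E) + C * E' * E) = 0 := by
  have ha (j : Fin 3) : a 0 j = a 0 0 * (ka * a 0 j) := by rw [← mul_assoc, hka.1, one_mul]
  have hb (j : Fin 3) : b 0 j = b 0 0 * (kb * b 0 j) := by rw [← mul_assoc, hkb.1, one_mul]
  have hkc₂C : (c 1 1 - c 1 0 * kc * c 0 1) * C = c 1 2 - c 1 0 * kc * c 0 2 := by
    rw [hC, ← mul_assoc, hkc₂.1, one_mul]
  set X := kc * c 0 1 * C - kc * c 0 2 with hX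
  have h₀ : c 0 1 * C - c 0 0 * X = c 0 2 := by
    rw [hX]
    linear_combination (norm := noncomm_ring) -hkc.1 * (c 0 1 * C - c 0 2)
  have h₁ : c 1 1 * C - c 1 0 * X = c 1 2 := by
    rw [hX]
    linear_combination (norm := noncomm_ring) hkc₂C
  have hc (r s : R) (h₀ : c 0 0 * r + c 0 1 * s = 0) (h₁ : c 1 0 * r + c 1 1 * s = 0) :
      r = 0 ∧ s = 0 := by
    have hs : s = 0 := by
      linear_combination (norm := noncomm_ring) kc₂ * h₁ - kc₂ * c 1 0 * kc * h₀ - hkc₂.2 * s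
        + kc₂ * c 1 0 * hkc.2 * r
    refine ⟨?_, hs⟩
    rw [hs, mul_zero, add_zero] at h₀
    linear_combination (norm := noncomm_ring) kc * h₀ - hkc.2 * r
  have row (i j : Fin 3) (hd : (h * h) •
      (ka * a 0 i * (ka * a 0 j) - ka * a 0 j * (ka * a 0 i)) = 0) :
      h • (x • ((ka * a 0 i) * (kb * b 0 j) - (kb * b 0 j) * (ka * a 0 i)) +
        h • ((ka * a 0 i - kb * b 0 i) * (ka * a 0 j - kb * b 0 j))) = 0 :=
    hx _ <| by
      linear_combination (norm := module) h • first_row_exchange hx hab hka hkb i j + x • hd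
  have ac := column_exchange hy hac hka.2 (ha 1) (ha 2) h₀ h₁ hc
  have bc := column_exchange hz hbc hkb.2 (hb 1) (hb 2) h₀ h₁ hc
  rw [hE, hE']
  refine serre_of_exchange hxyz hx' hy hz hyh hzh ac.1 ac.2 bc.1 bc.2
    (hx _ ?_) (row 1 2 hd) (row 2 1 ?_) hd hd'
  · rw [first_row_exchange hx hab hka hkb 1 1, sub_self, smul_zero]
  · rw [← neg_sub, smul_neg, hd, neg_zero]

end Exchange

section PowerSeriesRTT

open PowerSeries

/-- A power series with constant coefficient one has a two-sided inverse. -/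
theorem exists_inverse {B : Type*} [Ring B] (p : PowerSeries B) (hp : constantCoeff p = 1) :
    ∃ q, p * q = 1 ∧ q * p = 1 :=
  ⟨invOfUnit p 1, mul_invOfUnit p 1 (by simpa using hp), invOfUnit_mul p 1 (by simpa using hp)⟩

/-- Left multiplication by `b` is injective. -/
def LeftReg {B : Type*} [Ring B] (b : B) : Prop := ∀ r, b * r = 0 → r = 0

theorem LeftReg.mul {B : Type*} [Ring B] {b c : B} (hb : LeftReg b) (hc : LeftReg c) :
    LeftReg (b * c) := fun r hr ↦ hc r (hb _ (by rwa [← mul_assoc]))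

theorem leftReg_X {B : Type*} [Ring B] : LeftReg (X : PowerSeries B) := fun r hr ↦ by
  ext n
  rw [← coeff_succ_X_mul, hr, map_zero, map_zero]

theorem LeftReg.C {B : Type*} [Ring B] {b : B} (hb : LeftReg b) :
    LeftReg (PowerSeries.C b) := fun r hr ↦ by
  ext n
  exact hb _ (by rw [← coeff_C_mul, hr, map_zero])

theorem LeftReg.X_mul_sub {B : Type*} [Ring B] {b : B} (hb : LeftReg b) (c : B) :
    LeftReg (X * PowerSeries.C c - PowerSeries.C b) := fun r hr ↦ by
  ext n
  induction n with
  | zero =>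
    refine hb _ ?_
    simpa [sub_mul, mul_assoc, coeff_zero_X_mul] using congrArg (coeff 0) hr
  | succ n ih =>
    refine hb _ ?_
    have e := congrArg (coeff (n + 1)) hr
    rw [sub_mul, mul_assoc, map_sub, coeff_succ_X_mul, coeff_C_mul, coeff_C_mul, ih] at e
    simpa using e

theorem LeftReg.X_sub_add {B : Type*} [Ring B] {b : B} (hb : LeftReg b) (s : B) :
    LeftReg (X - PowerSeries.C b + PowerSeries.C s * PowerSeries.C b * X) := by
  have e := hb.X_mul_sub (1 + s * b)
  rwa [map_add, map_one, map_mul, mul_add, mul_one, ← (commute_X _).eq, add_sub_right_comm] at e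

theorem C_mem_center {B : Type*} [Ring B] {b : B} (hb : b ∈ Subring.center B) :
    C b ∈ Subring.center (PowerSeries B) := by
  rw [Subring.mem_center_iff] at hb ⊢
  intro g
  ext n
  rw [coeff_mul_C, coeff_C_mul, hb]

theorem X_mem_center {B : Type*} [Ring B] : X ∈ Subring.center (PowerSeries B) :=
  Subring.mem_center_iff.2 fun g ↦ commute_X g

/-- If `(u - v + h)⁻¹ d(u)` has an expansion with bounded powers of `u`, then `d = 0`. -/
theorem eq_zero_of_sub_add_mul_eq {B : Type*} [Ring B] {t : B} {d : PowerSeries B}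
    {V : PowerSeries (PowerSeries B)}
    (hV : (X - C X + C (C t * X) * X) * V = C d * X ^ 2) : d = 0 := by
  have hcoeff (n : ℕ) : coeff n V + C t * X * coeff n V - X * coeff (n + 1) V =
      if n = 1 then d else 0 := by
    have e := congrArg (coeff (n + 1)) hV
    rw [add_mul, sub_mul, mul_assoc (C (C t * X)), map_add, map_sub, coeff_succ_X_mul, coeff_C_mul,
      coeff_C_mul, coeff_succ_X_mul, coeff_C_mul, coeff_X_pow] at e
    rw [add_sub_right_comm, e]
    by_cases hn : n = 1 <;> simp [hn]
  have h₀ : coeff 0 V = 0 := leftReg_X _ <| by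
    have e := congrArg (coeff 0) hV
    rw [add_mul, sub_mul, mul_assoc (C (C t * X)), map_add, map_sub, coeff_zero_X_mul, coeff_C_mul,
      coeff_C_mul, coeff_zero_X_mul, coeff_C_mul, coeff_X_pow] at e
    simpa using e
  have h₁ : coeff 1 V = 0 := leftReg_X _ <| by simpa [h₀] using hcoeff 0
  have h₂ (m n : ℕ) : coeff m (coeff (n + 2) V) = 0 := by
    induction m generalizing n with
    | zero => simpa [mul_assoc, coeff_zero_X_mul] using congrArg (coeff 0) (hcoeff (n + 2))
    | succ m ih =>
      have e := congrArg (coeff (m + 1)) (hcoeff (n + 2))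
      rw [mul_assoc, map_sub, map_add, coeff_succ_X_mul, coeff_C_mul, coeff_succ_X_mul, ih, ih] at e
      simpa using e
  have h₂' : coeff 2 V = 0 := by ext m; exact h₂ m 0
  simpa [h₁, h₂'] using (hcoeff 1).symm

/-- The RTT relation for power series in `w = u⁻¹`, inside `A⟦u⁻¹⟧⟦v⁻¹⟧`. -/
def SeriesRTT (h : A) (l : Fin 3 → Fin 3 → PowerSeries A) : Prop :=
  ∀ i j k m : Fin 3,
    (X - C X) * (C (l i j) * map C (l k m) - map C (l k m) * C (l i j)) =
      C (C h) * C X * X * (map C (l k j) * C (l i m) - C (l k j) * map C (l i m))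

section TwoVariables

variable (h : A) (hcen : h ∈ Subring.center A)

/-- The variable `u⁻¹` as a central element of `A⟦u⁻¹⟧⟦v⁻¹⟧`. -/
def innerVar (A : Type*) [Ring A] : Subring.center (PowerSeries (PowerSeries A)) :=
  ⟨C X, C_mem_center X_mem_center⟩

/-- The variable `v⁻¹` as a central element of `A⟦u⁻¹⟧⟦v⁻¹⟧`. -/
def outerVar (A : Type*) [Ring A] : Subring.center (PowerSeries (PowerSeries A)) :=
  ⟨X, X_mem_center⟩

/-- The scalar `h` as a central element of `A⟦u⁻¹⟧⟦v⁻¹⟧`. -/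
def centralScalar : Subring.center (PowerSeries (PowerSeries A)) :=
  ⟨C (C h), C_mem_center (C_mem_center hcen)⟩

variable {h}

theorem SeriesRTT.exchange {l : Fin 3 → Fin 3 → PowerSeries A} (H : SeriesRTT h l) :
    Exchange (outerVar A - innerVar A) (centralScalar h hcen * innerVar A * outerVar A)
      (fun i j ↦ C (l i j)) (fun i j ↦ map C (l i j)) :=
  H

theorem eq_zero_of_sub_add_smul {r : PowerSeries (PowerSeries A)}
    (hr : (outerVar A - innerVar A + centralScalar h hcen * innerVar A * outerVar A) • r = 0) :
    r = 0 := by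
  exact leftReg_X.X_sub_add (C h) r hr

theorem sq_mul_eq_zero_of_smul_eq {d : PowerSeries A} {V : PowerSeries (PowerSeries A)}
    (hV : (outerVar A - innerVar A + centralScalar h hcen * innerVar A * outerVar A) • V =
      ((outerVar A - innerVar A) * (centralScalar h hcen * innerVar A * outerVar A)) • C d) :
    C (h * h) * d = 0 := by
  have e : (outerVar A - innerVar A + centralScalar h hcen * innerVar A * outerVar A) •
      (V - (centralScalar h hcen * innerVar A * outerVar A) • C d) =
      (-(innerVar A * innerVar A * (centralScalar h hcen * centralScalar h hcen)) *
        (outerVar A) ^ 2) • C d := by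
    rw [smul_sub, hV]
    module
  have e' : -(X * (X * (C (h * h) * d))) = 0 := by
    refine eq_zero_of_sub_add_mul_eq (t := h)
      (V := V - (centralScalar h hcen * innerVar A * outerVar A) • C d) ?_
    rw [Subring.smul_def, Subring.smul_def] at e
    simp only [outerVar, innerVar, centralScalar, Subring.coe_add, AddSubgroupClass.coe_sub,
      Subring.coe_mul, Subring.coe_neg, Subring.coe_pow] at e
    rw [map_mul C (C h) X, Subring.smul_def]
    refine e.trans ?_
    simp only [Subring.smul_def, smul_eq_mul, Subring.coe_mul, Subring.coe_neg, Subring.coe_pow]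
    rw [mul_assoc, (commute_X_pow (C d) 2).symm.eq, ← mul_assoc]
    simp only [map_mul, map_neg, mul_assoc, neg_mul]
  exact leftReg_X _ (leftReg_X _ (neg_eq_zero.1 e'))

theorem SeriesRTT.sq_mul_comm_upper (hcen : h ∈ Subring.center A)
    {l : Fin 3 → Fin 3 → PowerSeries A} (H : SeriesRTT h l)
    {q : PowerSeries A} (hq : l 0 0 * q = 1 ∧ q * l 0 0 = 1) :
    C (h * h) * (q * l 0 1 * (q * l 0 2) - q * l 0 2 * (q * l 0 1)) = 0 := by
  have := first_row_exchange (fun r ↦ eq_zero_of_sub_add_smul hcen) (H.exchange hcen)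
    (ki := C q) (ki' := map C q) (by simp only [← map_mul, hq, map_one, and_self])
    (by simp only [← map_mul, hq, map_one, and_self]) 1 2
  refine sq_mul_eq_zero_of_smul_eq hcen (this.trans ?_)
  simp only [map_sub, map_mul]

theorem SeriesRTT.sq_mul_comm_lower (hcen : h ∈ Subring.center A)
    {l : Fin 3 → Fin 3 → PowerSeries A} (H : SeriesRTT h l)
    {q : PowerSeries A} (hq : l 0 0 * q = 1 ∧ q * l 0 0 = 1) :
    C (h * h) * (l 2 0 * q * (l 1 0 * q) - l 1 0 * q * (l 2 0 * q)) = 0 := by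
  have := congrArg MulOpposite.unop <| first_row_exchange
    (fun r hr ↦ MulOpposite.unop_injective
      (eq_zero_of_sub_add_smul hcen (congrArg MulOpposite.unop hr))) (H.exchange hcen).op
    (ki := .op (C q)) (ki' := .op (map C q))
    (by simp only [← map_mul, ← MulOpposite.op_mul, hq, map_one, MulOpposite.op_one, and_self])
    (by simp only [← map_mul, ← MulOpposite.op_mul, hq, map_one, MulOpposite.op_one, and_self]) 1 2
  rw [MulOpposite.unop_smul, MulOpposite.unop_smul] at this
  refine sq_mul_eq_zero_of_smul_eq hcen (this.trans ?_)
  simp only [map_sub, map_mul, MulOpposite.unop_sub, MulOpposite.unop_mul, MulOpposite.unop_op]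

end TwoVariables

section ThreeVariables

/-- Embedding of series in `u₁⁻¹` into `A⟦u₁⁻¹⟧⟦u₂⁻¹⟧⟦v⁻¹⟧`. -/
def toFst (A : Type*) [Ring A] : PowerSeries A →+* PowerSeries (PowerSeries (PowerSeries A)) :=
  C.comp C

/-- Embedding of series in `u₂⁻¹` into `A⟦u₁⁻¹⟧⟦u₂⁻¹⟧⟦v⁻¹⟧`. -/
def toSnd (A : Type*) [Ring A] : PowerSeries A →+* PowerSeries (PowerSeries (PowerSeries A)) :=
  C.comp (map C)

/-- Embedding of series in `v⁻¹` into `A⟦u₁⁻¹⟧⟦u₂⁻¹⟧⟦v⁻¹⟧`. -/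
def toTrd (A : Type*) [Ring A] : PowerSeries A →+* PowerSeries (PowerSeries (PowerSeries A)) :=
  map (C.comp C)

theorem map_C_map_C (p : PowerSeries A) : map C (map C p) = toTrd A p := by
  ext : 1; simp [toTrd]

theorem map_map_C_map_C (p : PowerSeries A) : map (map C) (map C p) = toTrd A p := by
  ext : 1; simp [toTrd]

/-- The variable `u₁⁻¹` as a central element. -/
def var₁ (A : Type*) [Ring A] : Subring.center (PowerSeries (PowerSeries (PowerSeries A))) :=
  ⟨C (C X), C_mem_center (C_mem_center X_mem_center)⟩

/-- The variable `u₂⁻¹` as a central element. -/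
def var₂ (A : Type*) [Ring A] : Subring.center (PowerSeries (PowerSeries (PowerSeries A))) :=
  ⟨C X, C_mem_center X_mem_center⟩

/-- The variable `v⁻¹` as a central element. -/
def var₃ (A : Type*) [Ring A] : Subring.center (PowerSeries (PowerSeries (PowerSeries A))) :=
  ⟨X, X_mem_center⟩

/-- The scalar `h` as a central element of the ring of series in three variables. -/
def scalar₃ (h : A) (hcen : h ∈ Subring.center A) :
    Subring.center (PowerSeries (PowerSeries (PowerSeries A))) :=
  ⟨C (C (C h)), C_mem_center (C_mem_center (C_mem_center hcen))⟩

variable {h : A} (hcen : h ∈ Subring.center A)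

theorem SeriesRTT.exchange₁₂ {l : Fin 3 → Fin 3 → PowerSeries A} (H : SeriesRTT h l) :
    Exchange (var₂ A - var₁ A) (scalar₃ h hcen * var₁ A * var₂ A)
      (fun i j ↦ toFst A (l i j)) (fun i j ↦ toSnd A (l i j)) := by
  intro i j k m
  have e := congrArg C (H i j k m)
  simp only [map_mul, map_sub] at e
  exact e

theorem SeriesRTT.exchange₁₃ {l : Fin 3 → Fin 3 → PowerSeries A} (H : SeriesRTT h l) :
    Exchange (var₃ A - var₁ A) (scalar₃ h hcen * var₁ A * var₃ A)
      (fun i j ↦ toFst A (l i j)) (fun i j ↦ toTrd A (l i j)) := by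
  intro i j k m
  have e := congrArg (map C) (H i j k m)
  simp only [map_mul, map_sub, map_C, map_X, map_C_map_C] at e
  exact e

theorem SeriesRTT.exchange₂₃ {l : Fin 3 → Fin 3 → PowerSeries A} (H : SeriesRTT h l) :
    Exchange (var₃ A - var₂ A) (scalar₃ h hcen * var₂ A * var₃ A)
      (fun i j ↦ toSnd A (l i j)) (fun i j ↦ toTrd A (l i j)) := by
  intro i j k m
  have e := congrArg (map (map C)) (H i j k m)
  simp only [map_mul, map_sub, map_C, map_X, map_map_C_map_C] at e
  exact e

end ThreeVariables

end PowerSeriesRTT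

section Serre

open PowerSeries

variable {h : A} (hcen : h ∈ Subring.center A)

theorem eq_zero_of_smul₁₂ {r : PowerSeries (PowerSeries (PowerSeries A))}
    (hr : (var₃ A * (var₂ A - var₁ A) + scalar₃ h hcen * var₁ A * var₂ A * var₃ A) • r = 0) :
    r = 0 := by
  refine leftReg_X.mul (leftReg_X.X_sub_add (C h)).C r (Eq.trans ?_ hr)
  rw [mul_comm _ (var₃ A), ← mul_add]
  simp only [map_mul, map_add, map_sub]
  rfl

theorem eq_zero_of_smul₁₃ {r : PowerSeries (PowerSeries (PowerSeries A))}
    (hr : (var₂ A * (var₃ A - var₁ A) + scalar₃ h hcen * var₁ A * var₂ A * var₃ A) • r = 0) :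
    r = 0 := by
  refine leftReg_X.C.mul (leftReg_X.C.X_sub_add (C (C h))) r (Eq.trans ?_ hr)
  rw [mul_right_comm _ (var₂ A), mul_comm _ (var₂ A), ← mul_add]
  rfl

theorem eq_zero_of_smul₂₃ {r : PowerSeries (PowerSeries (PowerSeries A))}
    (hr : (var₁ A * (var₃ A - var₂ A) + scalar₃ h hcen * var₁ A * var₂ A * var₃ A) • r = 0) :
    r = 0 := by
  refine leftReg_X.C.C.mul (leftReg_X.X_sub_add (C (C h))) r (Eq.trans ?_ hr)
  rw [mul_right_comm (scalar₃ h hcen), mul_right_comm _ (var₁ A), mul_comm _ (var₁ A), ← mul_add]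
  rfl

theorem scalar₃_neg : scalar₃ (-h) (neg_mem hcen) = -scalar₃ h hcen :=
  Subtype.ext <| by simp [scalar₃]

theorem scalar₃_zero : scalar₃ (0 : A) (zero_mem _) = 0 :=
  Subtype.ext <| by simp [scalar₃]

theorem eq_zero_of_sub_smul₁₂ {r : PowerSeries (PowerSeries (PowerSeries A))}
    (hr : (var₃ A * (var₂ A - var₁ A) - scalar₃ h hcen * var₁ A * var₂ A * var₃ A) • r = 0) :
    r = 0 :=
  eq_zero_of_smul₁₂ (neg_mem hcen) <| by
    rwa [scalar₃_neg, neg_mul, neg_mul, neg_mul, ← sub_eq_add_neg]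

theorem eq_zero_of_var_smul₁₃ {r : PowerSeries (PowerSeries (PowerSeries A))}
    (hr : (var₂ A * (var₃ A - var₁ A)) • r = 0) : r = 0 :=
  eq_zero_of_smul₁₃ (zero_mem _) <| by rwa [scalar₃_zero, zero_mul, zero_mul, zero_mul, add_zero]

theorem eq_zero_of_var_smul₂₃ {r : PowerSeries (PowerSeries (PowerSeries A))}
    (hr : (var₁ A * (var₃ A - var₂ A)) • r = 0) : r = 0 :=
  eq_zero_of_smul₂₃ (zero_mem _) <| by rwa [scalar₃_zero, zero_mul, zero_mul, zero_mul, add_zero]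

theorem Exchange.smul {K R : Type*} [CommRing K] [Ring R] [Algebra K R] {x h : K}
    {a b : Fin 3 → Fin 3 → R} (H : Exchange x h a b) (t : K) : Exchange (t * x) (h * t) a b :=
  fun i j k l ↦ by rw [mul_smul, H, mul_comm h, mul_smul]

theorem scalar₃_sq_smul {p : PowerSeries A} (hp : C (h * h) * p = 0)
    {φ : PowerSeries A →+* PowerSeries (PowerSeries (PowerSeries A))}
    (hφ : φ (C h) = C (C (C h))) :
    (scalar₃ h hcen * var₁ A * var₂ A * var₃ A * (scalar₃ h hcen * var₁ A * var₂ A * var₃ A)) •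
      φ p = 0 := by
  rw [show scalar₃ h hcen * var₁ A * var₂ A * var₃ A *
    (scalar₃ h hcen * var₁ A * var₂ A * var₃ A) =
    (var₁ A * var₂ A * var₃ A) ^ 2 * (scalar₃ h hcen * scalar₃ h hcen) by ring, mul_smul]
  have e : (scalar₃ h hcen * scalar₃ h hcen) • φ p = φ (C (h * h) * p) := by
    rw [map_mul, map_mul, map_mul, hφ]
    rfl
  rw [e, hp, map_zero, smul_zero]

theorem SeriesRTT.serre_upper (hcen : h ∈ Subring.center A)
    {l : Fin 3 → Fin 3 → PowerSeries A} (H : SeriesRTT h l) {q q₂ : PowerSeries A}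
    (hq : l 0 0 * q = 1 ∧ q * l 0 0 = 1)
    (hq₂ : (l 1 1 - l 1 0 * q * l 0 1) * q₂ = 1 ∧ q₂ * (l 1 1 - l 1 0 * q * l 0 1) = 1)
    {e₁ e₂ : PowerSeries A} (he₁ : e₁ = q * l 0 1) (he₂ : e₂ = q₂ * (l 1 2 - l 1 0 * q * l 0 2)) :
    (toFst A e₁ * toSnd A e₁ * toTrd A e₂ - 2 * (toFst A e₁ * toTrd A e₂ * toSnd A e₁) +
        toTrd A e₂ * toFst A e₁ * toSnd A e₁) +
      (toSnd A e₁ * toFst A e₁ * toTrd A e₂ - 2 * (toSnd A e₁ * toTrd A e₂ * toFst A e₁) +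
        toTrd A e₂ * toSnd A e₁ * toFst A e₁) = 0 := by
  have e₁₃ := (H.exchange₁₃ hcen).smul (var₂ A)
  rw [mul_right_comm _ (var₃ A)] at e₁₃
  have e₂₃ := (H.exchange₂₃ hcen).smul (var₁ A)
  rw [mul_right_comm _ (var₃ A), mul_right_comm _ (var₂ A)] at e₂₃
  have d := H.sq_mul_comm_upper hcen hq
  refine gauss_serre (ka := toFst A q) (kb := toSnd A q) (kc := toTrd A q) (kc₂ := toTrd A q₂)
    (by ring) (fun r ↦ eq_zero_of_smul₁₂ hcen)
    (fun r ↦ eq_zero_of_sub_smul₁₂ hcen)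
    (fun r ↦ eq_zero_of_var_smul₁₃) (fun r ↦ eq_zero_of_var_smul₂₃)
    (fun r ↦ eq_zero_of_smul₁₃ hcen) (fun r ↦ eq_zero_of_smul₂₃ hcen)
    ((H.exchange₁₂ hcen).smul (var₃ A)) e₁₃ e₂₃ ?_ ?_ ?_ ?_ ?_ ?_
    (by rw [he₁, map_mul]) (by rw [he₁, map_mul]) (by rw [he₂, map_mul, map_sub, map_mul, map_mul])
  · simp only [← map_mul, hq, map_one, and_self]
  · simp only [← map_mul, hq, map_one, and_self]
  · simp only [← map_mul, hq, map_one, and_self]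
  · simp only [← map_mul, ← map_sub, hq₂, map_one, and_self]
  · rw [← scalar₃_sq_smul hcen d (φ := toFst A) rfl]
    simp only [map_mul, map_sub]
  · rw [← scalar₃_sq_smul hcen d (φ := toSnd A) (by simp [toSnd])]
    simp only [map_mul, map_sub]

theorem SeriesRTT.serre_lower (hcen : h ∈ Subring.center A)
    {l : Fin 3 → Fin 3 → PowerSeries A} (H : SeriesRTT h l) {q q₂ : PowerSeries A}
    (hq : l 0 0 * q = 1 ∧ q * l 0 0 = 1)
    (hq₂ : (l 1 1 - l 1 0 * q * l 0 1) * q₂ = 1 ∧ q₂ * (l 1 1 - l 1 0 * q * l 0 1) = 1)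
    {f₁ f₂ : PowerSeries A} (hf₁ : f₁ = l 1 0 * q) (hf₂ : f₂ = (l 2 1 - l 2 0 * q * l 0 1) * q₂) :
    (toFst A f₁ * toSnd A f₁ * toTrd A f₂ - 2 * (toFst A f₁ * toTrd A f₂ * toSnd A f₁) +
        toTrd A f₂ * toFst A f₁ * toSnd A f₁) +
      (toSnd A f₁ * toFst A f₁ * toTrd A f₂ - 2 * (toSnd A f₁ * toTrd A f₂ * toFst A f₁) +
        toTrd A f₂ * toSnd A f₁ * toFst A f₁) = 0 := by
  have e₁₃ := (H.exchange₁₃ hcen).smul (var₂ A)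
  rw [mul_right_comm _ (var₃ A)] at e₁₃
  have e₂₃ := (H.exchange₂₃ hcen).smul (var₁ A)
  rw [mul_right_comm _ (var₃ A), mul_right_comm _ (var₂ A)] at e₂₃
  have d := H.sq_mul_comm_lower hcen hq
  have hu {r : (PowerSeries (PowerSeries (PowerSeries A)))ᵐᵒᵖ} (h : r.unop = 0) : r = 0 :=
    MulOpposite.unop_injective h
  have main := gauss_serre (R := (PowerSeries (PowerSeries (PowerSeries A)))ᵐᵒᵖ)
    (ka := .op (toFst A q)) (kb := .op (toSnd A q)) (kc := .op (toTrd A q))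
    (kc₂ := .op (toTrd A q₂)) (E := .op (toFst A f₁)) (E' := .op (toSnd A f₁))
    (C := .op (toTrd A f₂))
    (by ring) (fun r hr ↦ hu (eq_zero_of_smul₁₂ hcen (congrArg MulOpposite.unop hr)))
    (fun r hr ↦ hu (eq_zero_of_sub_smul₁₂ hcen (congrArg MulOpposite.unop hr)))
    (fun r hr ↦ hu (eq_zero_of_var_smul₁₃ (congrArg MulOpposite.unop hr)))
    (fun r hr ↦ hu (eq_zero_of_var_smul₂₃ (congrArg MulOpposite.unop hr)))
    (fun r hr ↦ hu (eq_zero_of_smul₁₃ hcen (congrArg MulOpposite.unop hr)))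
    (fun r hr ↦ hu (eq_zero_of_smul₂₃ hcen (congrArg MulOpposite.unop hr)))
    ((H.exchange₁₂ hcen).smul (var₃ A)).op e₁₃.op e₂₃.op
    (by simp only [← map_mul, ← MulOpposite.op_mul, hq, map_one, MulOpposite.op_one, and_self])
    (by simp only [← map_mul, ← MulOpposite.op_mul, hq, map_one, MulOpposite.op_one, and_self])
    (by simp only [← map_mul, ← MulOpposite.op_mul, hq, map_one, MulOpposite.op_one, and_self])
    (by simp only [← map_mul, ← MulOpposite.op_mul, ← MulOpposite.op_sub, ← map_sub, ← mul_assoc,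
      hq₂, map_one, MulOpposite.op_one, and_self])
    (hu (by
      rw [← scalar₃_sq_smul hcen d (φ := toFst A) rfl]
      simp only [map_mul, map_sub, MulOpposite.unop_smul, MulOpposite.unop_mul,
        MulOpposite.unop_sub, MulOpposite.unop_op]))
    (hu (by
      rw [← scalar₃_sq_smul hcen d (φ := toSnd A) (by simp [toSnd])]
      simp only [map_mul, map_sub, MulOpposite.unop_smul, MulOpposite.unop_mul,
        MulOpposite.unop_sub, MulOpposite.unop_op]))
    (by rw [hf₁, map_mul, MulOpposite.op_mul]) (by rw [hf₁, map_mul, MulOpposite.op_mul])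
    (by simp only [hf₂, map_mul, map_sub, MulOpposite.op_mul, MulOpposite.op_sub, mul_assoc])
  have main' := congrArg MulOpposite.unop main
  simp only [two_mul, mul_add, MulOpposite.unop_add, MulOpposite.unop_sub, MulOpposite.unop_mul,
    MulOpposite.unop_op, MulOpposite.unop_zero, ← mul_assoc] at main'
  rw [← main']
  simp only [two_mul]
  abel

end Serre

section Transfer

open PowerSeries

/-- The inclusion of `A⟦u⁻¹⟧⟦v⁻¹⟧` in the ring of iterated Hahn series. -/
def hahn₂ (A : Type*) [Ring A] : PowerSeries (PowerSeries A) →+* TT A :=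
  (HahnSeries.ofPowerSeries ℤ _).comp (map (HahnSeries.ofPowerSeries ℤ A))

/-- The inclusion of `A⟦u₁⁻¹⟧⟦u₂⁻¹⟧⟦v⁻¹⟧` in the ring of iterated Hahn series. -/
def hahn₃ (A : Type*) [Ring A] : PowerSeries (PowerSeries (PowerSeries A)) →+* T3 A :=
  (HahnSeries.ofPowerSeries ℤ _).comp (map (hahn₂ A))

theorem hahn₂_injective : Function.Injective (hahn₂ A) := by
  intro p q hpq
  rw [hahn₂, RingHom.comp_apply, RingHom.comp_apply] at hpq
  have e := HahnSeries.ofPowerSeries_injective hpq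
  exact map_injective _ HahnSeries.ofPowerSeries_injective e

theorem hahn₂_C (p : PowerSeries A) :
    hahn₂ A (C p) = HahnSeries.single 0 (HahnSeries.ofPowerSeries ℤ A p) := by
  simp [hahn₂, HahnSeries.ofPowerSeries_C, HahnSeries.C_apply]

theorem hahn₂_X : hahn₂ A X = HahnSeries.single 1 1 := by
  simp [hahn₂, HahnSeries.ofPowerSeries_X]

theorem hahn₂_C_mk (a : ℕ → A) : hahn₂ A (C (mk a)) = inU a := hahn₂_C _

theorem hahn₂_map_C_mk (a : ℕ → A) : hahn₂ A (map C (mk a)) = inV a := by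
  rw [hahn₂, RingHom.comp_apply, inV, ofSeq]
  congr 1
  ext : 1
  simp [HahnSeries.ofPowerSeries_C, HahnSeries.C_apply]

theorem hahn₂_C_C (h : A) : hahn₂ A (C (C h)) = sc h := by
  rw [hahn₂_C, HahnSeries.ofPowerSeries_C, HahnSeries.C_apply, sc]

theorem hahn₂_C_X : hahn₂ A (C X) = HahnSeries.single 0 (HahnSeries.single 1 1) := by
  rw [hahn₂_C, HahnSeries.ofPowerSeries_X]

theorem hahn₃_toFst (a : ℕ → A) : hahn₃ A (toFst A (mk a)) = in1 a := by
  rw [hahn₃, toFst, RingHom.comp_apply, RingHom.comp_apply, map_C, HahnSeries.ofPowerSeries_C,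
    HahnSeries.C_apply, hahn₂_C_mk, in1]

theorem hahn₃_toSnd (a : ℕ → A) : hahn₃ A (toSnd A (mk a)) = in2 a := by
  rw [hahn₃, toSnd, RingHom.comp_apply, RingHom.comp_apply, map_C, HahnSeries.ofPowerSeries_C,
    HahnSeries.C_apply, hahn₂_map_C_mk, in2]

theorem hahn₃_toTrd (a : ℕ → A) : hahn₃ A (toTrd A (mk a)) = in3 a := by
  rw [hahn₃, RingHom.comp_apply, in3, ofSeq]
  congr 1
  ext : 1
  simp [toTrd, hahn₂_C_C]

theorem RTT.seriesRTT {h : A} {lgen : Fin 3 → Fin 3 → ℕ → A} (H : RTT h lgen) :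
    SeriesRTT h (fun i j ↦ mk (lcoef h lgen i j)) := by
  intro i j k m
  apply hahn₂_injective
  have hX : hahn₂ A (X - C X) = hahn₂ A (C X) * hahn₂ A X * (Uv A - Vv A) := by
    rw [map_sub, hahn₂_C_X, hahn₂_X, Uv, Vv]
    simp [mul_sub, HahnSeries.single_mul_single]
  have hc : C (C h) * C X * X = C X * X * C (C h) := by
    rw [mul_assoc (C X), ← (commute_X (C (C h))).eq, ← mul_assoc, ← map_mul, ← map_mul,
      (commute_X (C h)).eq]
  have hh : hahn₂ A (C (C h) * C X * X) = hahn₂ A (C X) * hahn₂ A X * sc h := by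
    rw [hc, map_mul, map_mul, hahn₂_C_C]
  rw [map_mul, map_mul, hX, hh, mul_assoc, mul_assoc _ (sc h)]
  simp only [map_sub, map_mul, hahn₂_C_mk, hahn₂_map_C_mk]
  rw [H i j k m]

/-- A Serre-type relation between the images of `p` and `q` in `A⟦u₁⁻¹⟧⟦u₂⁻¹⟧⟦v⁻¹⟧` holds
in the ring of iterated Hahn series. -/
theorem hahn₃_serre {p q : PowerSeries A}
    (H : (toFst A p * toSnd A p * toTrd A q - 2 * (toFst A p * toTrd A q * toSnd A p) +
        toTrd A q * toFst A p * toSnd A p) +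
      (toSnd A p * toFst A p * toTrd A q - 2 * (toSnd A p * toTrd A q * toFst A p) +
        toTrd A q * toSnd A p * toFst A p) = 0) {E E' F : T3 A}
    (hE : E = hahn₃ A (toFst A p)) (hE' : E' = hahn₃ A (toSnd A p))
    (hF : F = hahn₃ A (toTrd A q)) :
    (E * E' * F - 2 * (E * F * E') + F * E * E') +
      (E' * E * F - 2 * (E' * F * E) + F * E' * E) = 0 := by
  rw [hE, hE', hF, ← map_zero (hahn₃ A), ← H]
  simp only [two_mul, map_add, map_sub, map_mul]

theorem eq_map_of_inverse {R S : Type*} [Ring R] [Ring S] (φ : R →+* S) {p q : R}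
    (hpq : p * q = 1) {k ki : S} (hk : k = φ p) (hki : ki * k = 1) : ki = φ q := by
  rw [← mul_one ki, ← map_one φ, ← hpq, map_mul, ← hk, ← mul_assoc, hki, one_mul]

end Transfer

/-- Serre relations (2.101)–(2.102) for the Gauss coordinates:
`e₁(u₁)e₁(u₂)e₂(v) − 2e₁(u₁)e₂(v)e₁(u₂) + e₂(v)e₁(u₁)e₁(u₂) + {u₁ ↔ u₂} = 0` and
`f₁(u₁)f₁(u₂)f₂(v) − 2f₁(u₁)f₂(v)f₁(u₂) + f₂(v)f₁(u₁)f₁(u₂) + {u₁ ↔ u₂} = 0`. -/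
theorem stmt18 (h : A) (hcen : ∀ a : A, a * h = h * a)
    (lgen : Fin 3 → Fin 3 → ℕ → A) (hRTT : RTT h lgen)
    (k1inv1 k1inv2 k1inv3 k2inv3 : T3 A)
    (hk11 : gk1 in1 h lgen * k1inv1 = 1 ∧ k1inv1 * gk1 in1 h lgen = 1)
    (hk12 : gk1 in2 h lgen * k1inv2 = 1 ∧ k1inv2 * gk1 in2 h lgen = 1)
    (hk13 : gk1 in3 h lgen * k1inv3 = 1 ∧ k1inv3 * gk1 in3 h lgen = 1)
    (hk23 : gk2 in3 h lgen k1inv3 * k2inv3 = 1 ∧ k2inv3 * gk2 in3 h lgen k1inv3 = 1) :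
    (ge1 in1 h lgen k1inv1 * ge1 in2 h lgen k1inv2 * ge2 in3 h lgen k1inv3 k2inv3 -
        2 * (ge1 in1 h lgen k1inv1 * ge2 in3 h lgen k1inv3 k2inv3 * ge1 in2 h lgen k1inv2) +
        ge2 in3 h lgen k1inv3 k2inv3 * ge1 in1 h lgen k1inv1 * ge1 in2 h lgen k1inv2) +
      (ge1 in2 h lgen k1inv2 * ge1 in1 h lgen k1inv1 * ge2 in3 h lgen k1inv3 k2inv3 -
        2 * (ge1 in2 h lgen k1inv2 * ge2 in3 h lgen k1inv3 k2inv3 * ge1 in1 h lgen k1inv1) +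
        ge2 in3 h lgen k1inv3 k2inv3 * ge1 in2 h lgen k1inv2 * ge1 in1 h lgen k1inv1) = 0 ∧
    (gf1 in1 h lgen k1inv1 * gf1 in2 h lgen k1inv2 * gf2 in3 h lgen k1inv3 k2inv3 -
        2 * (gf1 in1 h lgen k1inv1 * gf2 in3 h lgen k1inv3 k2inv3 * gf1 in2 h lgen k1inv2) +
        gf2 in3 h lgen k1inv3 k2inv3 * gf1 in1 h lgen k1inv1 * gf1 in2 h lgen k1inv2) +
      (gf1 in2 h lgen k1inv2 * gf1 in1 h lgen k1inv1 * gf2 in3 h lgen k1inv3 k2inv3 -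
        2 * (gf1 in2 h lgen k1inv2 * gf2 in3 h lgen k1inv3 k2inv3 * gf1 in1 h lgen k1inv1) +
        gf2 in3 h lgen k1inv3 k2inv3 * gf1 in2 h lgen k1inv2 * gf1 in1 h lgen k1inv1) = 0 := by
  have H := hRTT.seriesRTT
  have hcen' : h ∈ Subring.center A := Subring.mem_center_iff.2 hcen
  set l : Fin 3 → Fin 3 → PowerSeries A := fun i j ↦ .mk (lcoef h lgen i j) with hl
  have hl₀ (i j : Fin 3) : (l i j).constantCoeff = if i = j then 1 else 0 := by
    simp [hl, lcoef, ← PowerSeries.coeff_zero_eq_constantCoeff_apply]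
  obtain ⟨q, hq⟩ := exists_inverse (l 0 0) (by simp [hl₀])
  obtain ⟨q₂, hq₂⟩ := exists_inverse (l 1 1 - l 1 0 * q * l 0 1) (by simp [hl₀])
  have h₁ (i j : Fin 3) : in1 (lcoef h lgen i j) = hahn₃ A (toFst A (l i j)) :=
    (hahn₃_toFst _).symm
  have h₂ (i j : Fin 3) : in2 (lcoef h lgen i j) = hahn₃ A (toSnd A (l i j)) :=
    (hahn₃_toSnd _).symm
  have h₃ (i j : Fin 3) : in3 (lcoef h lgen i j) = hahn₃ A (toTrd A (l i j)) :=
    (hahn₃_toTrd _).symm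
  obtain rfl := eq_map_of_inverse ((hahn₃ A).comp (toFst A)) hq.1 (h₁ 0 0) hk11.2
  obtain rfl := eq_map_of_inverse ((hahn₃ A).comp (toSnd A)) hq.1 (h₂ 0 0) hk12.2
  obtain rfl := eq_map_of_inverse ((hahn₃ A).comp (toTrd A)) hq.1 (h₃ 0 0) hk13.2
  have hqk (p r : PowerSeries A) : p * q * l 0 0 * (q * r) = p * q * r := by
    rw [mul_assoc p, hq.2, mul_one, mul_assoc]
  obtain rfl := eq_map_of_inverse ((hahn₃ A).comp (toTrd A)) hq₂.1 (by
    simp only [gk2, gf1, gk1, ge1, h₃, RingHom.comp_apply, ← map_mul, ← map_sub, hqk]) hk23.2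
  constructor
  · refine hahn₃_serre (H.serre_upper hcen' hq hq₂ rfl rfl) ?_ ?_ ?_
    · simp only [ge1, h₁, RingHom.comp_apply, map_mul]
    · simp only [ge1, h₂, RingHom.comp_apply, map_mul]
    · simp only [ge2, gf1, gk1, ge13, h₃, RingHom.comp_apply, ← map_mul, ← map_sub, hqk]
  · refine hahn₃_serre (H.serre_lower hcen' hq hq₂ rfl rfl) ?_ ?_ ?_
    · simp only [gf1, h₁, RingHom.comp_apply, map_mul]
    · simp only [gf1, h₂, RingHom.comp_apply, map_mul]
    · simp only [gf2, gf31, gk1, ge1, h₃, RingHom.comp_apply, ← map_mul, ← map_sub, hqk]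
end
end
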